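/- arXiv:0903.0702 — 4 statements merged into one kernel-verified Lean document; each statement's English description precedes it below -/
import Mathlib

section
/- Let P₁ and P₂ be probability measures on Ω = Ω_X × Ω_Y belonging to 𝒫_f. Suppose their marginals agree, P₁^X = P₂^X and P₁^Y = P₂^Y, and that they admit everywhere positive density versions p₁ = dP₁/d(P₁^X × P₁^Y) and p₂ = dP₂/d(P₂^X × P₂^Y) whose odds ratio functions coincide, OR_{p₁}(x,y) = OR_{p₂}(x,y) for all (x,y) ∈ Ω. Then P₁ = P₂. -/
open MeasureTheory

noncomputable section

/-- The odds ratio function of a (positive) density `p` on `ΩX × ΩY` with respect to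
reference values `x°`, `y°`. -/
def oddsRatioFn {ΩX ΩY : Type*} (p : ΩX × ΩY → ℝ) (x₀ : ΩX) (y₀ : ΩY)
    (z : ΩX × ΩY) : ℝ :=
  p z * p (x₀, y₀) / (p (z.1, y₀) * p (x₀, z.2))

/-- If a sum of a function of `x` and a function of `y` is integrable for a product of probability
measures, then both summands are integrable. -/
theorem integrable_and_integrable_of_integrable_add_prod
    {α β : Type*} [MeasurableSpace α] [MeasurableSpace β]
    {μ : Measure α} {ν : Measure β} [IsProbabilityMeasure μ] [IsProbabilityMeasure ν]
    {f : α → ℝ} {g : β → ℝ}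
    (h : Integrable (fun z : α × β => f z.1 + g z.2) (μ.prod ν)) :
    Integrable f μ ∧ Integrable g ν := by
  constructor
  · obtain ⟨y, hy⟩ := h.prod_left_ae.exists
    simpa [Pi.sub_def] using hy.sub (integrable_const (g y))
  · obtain ⟨x, hx⟩ := h.prod_right_ae.exists
    simpa [Pi.sub_def] using hx.sub (integrable_const (f x))

/-- The integral of a sum of a function of `x` and a function of `y` depends only on the marginals
of the measure. -/
theorem integrable_and_integral_add_of_marginals
    {α β : Type*} [MeasurableSpace α] [MeasurableSpace β]
    {P : Measure (α × β)} {f : α → ℝ} {g : β → ℝ}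
    (hf : Integrable f (P.map Prod.fst)) (hg : Integrable g (P.map Prod.snd)) :
    Integrable (fun z => f z.1 + g z.2) P ∧
      ∫ z, (f z.1 + g z.2) ∂P = ∫ x, f x ∂(P.map Prod.fst) + ∫ y, g y ∂(P.map Prod.snd) := by
  have hf' : Integrable (fun z : α × β => f z.1) P := hf.comp_measurable measurable_fst
  have hg' : Integrable (fun z : α × β => g z.2) P := hg.comp_measurable measurable_snd
  refine ⟨hf'.add hg', ?_⟩
  rw [integral_add hf' hg', integral_map measurable_fst.aemeasurable hf.aestronglyMeasurable,
    integral_map measurable_snd.aemeasurable hg.aestronglyMeasurable]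

/-- Integration against a measure with a positive real density. -/
theorem integrable_mul_and_integral_withDensity_ofReal
    {α : Type*} [MeasurableSpace α] {μ : Measure α} {p f : α → ℝ}
    (hp : Measurable p) (hpos : ∀ z, 0 < p z)
    (hf : Integrable f (μ.withDensity fun z => ENNReal.ofReal (p z))) :
    Integrable (fun z => p z * f z) μ ∧
      ∫ z, f z ∂(μ.withDensity fun z => ENNReal.ofReal (p z)) = ∫ z, p z * f z ∂μ := by
  have hlt : ∀ᵐ z ∂μ, ENNReal.ofReal (p z) < ⊤ := ae_of_all _ fun _ => ENNReal.ofReal_lt_top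
  constructor
  · simpa [ENNReal.toReal_ofReal (hpos _).le] using
      (integrable_withDensity_iff_integrable_smul' hp.ennreal_ofReal hlt).1 hf
  · rw [integral_withDensity_eq_integral_toReal_smul hp.ennreal_ofReal hlt]
    simp [ENNReal.toReal_ofReal (hpos _).le]

/-- The quantity `(a - b) * (log a - log b)` is nonnegative, and vanishes only for `a = b`. -/
theorem sub_mul_log_sub_log_pos {a b : ℝ} (ha : 0 < a) (hb : 0 < b) (hab : a ≠ b) :
    0 < (a - b) * (Real.log a - Real.log b) := by
  rcases hab.lt_or_gt with h | h
  · exact mul_pos_of_neg_of_neg (sub_neg.2 h) (sub_neg.2 (Real.log_lt_log ha h))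
  · exact mul_pos (sub_pos.2 h) (sub_pos.2 (Real.log_lt_log hb h))

/-- The logarithm of the odds ratio function of a positive density. -/
theorem log_oddsRatioFn {ΩX ΩY : Type*} {p : ΩX × ΩY → ℝ} (hp : ∀ z, 0 < p z)
    (x₀ : ΩX) (y₀ : ΩY) (z : ΩX × ΩY) :
    Real.log (oddsRatioFn p x₀ y₀ z) =
      Real.log (p z) + Real.log (p (x₀, y₀)) -
        (Real.log (p (z.1, y₀)) + Real.log (p (x₀, z.2))) := by
  have h := fun z => (hp z).ne'
  rw [oddsRatioFn, Real.log_div (mul_ne_zero (h _) (h _)) (mul_ne_zero (h _) (h _)),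
    Real.log_mul (h _) (h _), Real.log_mul (h _) (h _)]

/-- Theorem 1 (Uniqueness) of Osius, *Asymptotic inference for semiparametric
association models*: a probability measure in `𝒫_f` is uniquely determined by its two
marginal distributions together with its odds ratio function. -/
theorem uniqueness_of_association
    {ΩX ΩY : Type*} [MeasurableSpace ΩX] [MeasurableSpace ΩY]
    (x₀ : ΩX) (y₀ : ΩY)
    (P₁ P₂ : Measure (ΩX × ΩY))
    [IsProbabilityMeasure P₁] [IsProbabilityMeasure P₂]
    (p₁ p₂ : ΩX × ΩY → ℝ)
    (hp₁_meas : Measurable p₁) (hp₂_meas : Measurable p₂)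
    (hp₁_pos : ∀ z, 0 < p₁ z) (hp₂_pos : ∀ z, 0 < p₂ z)
    -- pᵢ is a density version of dPᵢ/d(Pᵢ^X × Pᵢ^Y)
    (hp₁_dens : P₁ = ((P₁.map Prod.fst).prod (P₁.map Prod.snd)).withDensity
      (fun z => ENNReal.ofReal (p₁ z)))
    (hp₂_dens : P₂ = ((P₂.map Prod.fst).prod (P₂.map Prod.snd)).withDensity
      (fun z => ENNReal.ofReal (p₂ z)))
    -- Pᵢ ∈ 𝒫_f : log pᵢ is integrable w.r.t. the product of the marginals
    (hp₁_logint : Integrable (fun z => Real.log (p₁ z))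
      ((P₁.map Prod.fst).prod (P₁.map Prod.snd)))
    (hp₂_logint : Integrable (fun z => Real.log (p₂ z))
      ((P₂.map Prod.fst).prod (P₂.map Prod.snd)))
    -- equal marginals
    (hX : P₁.map Prod.fst = P₂.map Prod.fst)
    (hY : P₁.map Prod.snd = P₂.map Prod.snd)
    -- equal odds ratio functions
    (hOR : ∀ z, oddsRatioFn p₁ x₀ y₀ z = oddsRatioFn p₂ x₀ y₀ z) :
    P₁ = P₂ := by
  have : IsProbabilityMeasure (P₁.map Prod.fst) :=
    Measure.isProbabilityMeasure_map measurable_fst.aemeasurable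
  have : IsProbabilityMeasure (P₁.map Prod.snd) :=
    Measure.isProbabilityMeasure_map measurable_snd.aemeasurable
  rw [← hX, ← hY] at hp₂_dens hp₂_logint
  set μ := P₁.map Prod.fst
  set ν := P₁.map Prod.snd
  let f : ΩX → ℝ := fun x => Real.log (p₁ (x, y₀)) - Real.log (p₂ (x, y₀))
  let g : ΩY → ℝ := fun y => Real.log (p₁ (x₀, y)) - Real.log (p₂ (x₀, y)) -
    (Real.log (p₁ (x₀, y₀)) - Real.log (p₂ (x₀, y₀)))
  have hfg : ∀ z, f z.1 + g z.2 = Real.log (p₁ z) - Real.log (p₂ z) := fun z => by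
    have h := congrArg Real.log (hOR z)
    rw [log_oddsRatioFn hp₁_pos, log_oddsRatioFn hp₂_pos] at h
    simp only [f, g]
    linarith
  obtain ⟨hf, hg⟩ : Integrable f μ ∧ Integrable g ν :=
    integrable_and_integrable_of_integrable_add_prod
      ((hp₁_logint.sub hp₂_logint).congr (ae_of_all _ fun z => (hfg z).symm))
  obtain ⟨hi₁, he₁⟩ := integrable_and_integral_add_of_marginals hf hg
  obtain ⟨hi₂, he₂⟩ := integrable_and_integral_add_of_marginals (hX ▸ hf) (hY ▸ hg)
  rw [← hX, ← hY, ← he₁] at he₂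
  rw [hp₁_dens] at hi₁
  rw [hp₂_dens] at hi₂
  obtain ⟨hm₁, hd₁⟩ := integrable_mul_and_integral_withDensity_ofReal hp₁_meas hp₁_pos hi₁
  obtain ⟨hm₂, hd₂⟩ := integrable_mul_and_integral_withDensity_ofReal hp₂_meas hp₂_pos hi₂
  rw [← hp₁_dens] at hd₁
  rw [← hp₂_dens] at hd₂
  have hzero : ∫ z, (p₁ z * (f z.1 + g z.2) - p₂ z * (f z.1 + g z.2)) ∂(μ.prod ν) = 0 := by
    rw [integral_sub hm₁ hm₂, ← hd₁, ← hd₂, he₂, sub_self]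
  have hfactor : ∀ z, p₁ z * (f z.1 + g z.2) - p₂ z * (f z.1 + g z.2) =
      (p₁ z - p₂ z) * (Real.log (p₁ z) - Real.log (p₂ z)) := fun z => by
    rw [hfg, sub_mul]
  have hnonneg : ∀ z, 0 ≤ p₁ z * (f z.1 + g z.2) - p₂ z * (f z.1 + g z.2) := fun z => by
    rw [hfactor]
    by_cases h : p₁ z = p₂ z
    · simp [h]
    · exact (sub_mul_log_sub_log_pos (hp₁_pos z) (hp₂_pos z) h).le
  have hae := (integral_eq_zero_iff_of_nonneg hnonneg (hm₁.sub hm₂)).1 hzero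
  rw [hp₁_dens, hp₂_dens]
  refine withDensity_congr_ae ?_
  filter_upwards [hae] with z hz
  by_contra h
  have hne : p₁ z ≠ p₂ z := fun h' => h (by rw [h'])
  exact (sub_mul_log_sub_log_pos (hp₁_pos z) (hp₂_pos z) hne).ne' ((hfactor z).symm.trans hz)
end
end

section
/- Let π_X and π_Y be probability measures on Ω_X and Ω_Y respectively, π = π_X × π_Y, and let ψ : Ω → ℝ be measurable with ψ(x,y°) = 0 and ψ(x°,y) = 0 for all x ∈ Ω_X, y ∈ Ω_Y. Assume ψ is π-integrable, and that there exist a π_X-integrable function β : Ω_X → ℝ and a π_Y-integrable function γ : Ω_Y → ℝ such that ∫ exp(ψ(x,y) − β(x) − γ(y)) dπ(x,y) < ∞. Then there exist measurable functions a : Ω_X → ℝ and c : Ω_Y → ℝ such that the measure P on Ω defined by dP/dπ(x,y) = exp(a(x) + c(y) + ψ(x,y)) is a probability measure whose marginals are P^X = π_X and P^Y = π_Y and for which the Kullback–Leibler divergence of π from P is finite. In particular P and P^X × P^Y = π are mutually absolutely continuous and the odds ratio function of the density exp(a(x)+c(y)+ψ(x,y)) equals exp(ψ(x,y)). -/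
open MeasureTheory

noncomputable section

open Filter Topology

/-- If the functions in a midpoint-convex class `V` satisfy the required integrability, then
`h ↦ ∫ (exp h - h)` has a minimizing sequence in `V` converging a.e. to an integrable function at
which the functional is at most its infimum over `V`. The key point is that `exp (h / 2)` is
Cauchy in `L²` along a minimizing sequence. -/
theorem exists_ae_tendsto_minimizer {Ω : Type*} [MeasurableSpace Ω] {μ : Measure Ω}
    {V : Set (Ω → ℝ)} (hne : V.Nonempty) (hint : ∀ h ∈ V, Integrable h μ)
    (hexp : ∀ h ∈ V, Integrable (fun z => Real.exp (h z)) μ)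
    (hmid : ∀ f ∈ V, ∀ g ∈ V, (fun z => (f z + g z) / 2) ∈ V) :
    ∃ (u : ℕ → Ω → ℝ) (h : Ω → ℝ), (∀ n, u n ∈ V) ∧ Integrable h μ ∧
      Integrable (fun z => Real.exp (h z)) μ ∧
      (∀ᵐ z ∂μ, Tendsto (fun n => u n z) atTop (𝓝 (h z))) ∧
      ∀ g ∈ V, ∫ z, (Real.exp (h z) - h z) ∂μ ≤ ∫ z, (Real.exp (g z) - g z) ∂μ := by
  set J : (Ω → ℝ) → ℝ := fun h => ∫ z, (Real.exp (h z) - h z) ∂μ with hJ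
  have hpos : ∀ t : ℝ, 0 ≤ Real.exp t - t := fun t => by linarith [Real.add_one_le_exp t]
  have hJint : ∀ h ∈ V, Integrable (fun z => Real.exp (h z) - h z) μ :=
    fun h hh => (hexp h hh).sub (hint h hh)
  have hbdd : BddBelow (J '' V) := ⟨0, by
    rintro _ ⟨h, -, rfl⟩
    exact integral_nonneg fun z => hpos _⟩
  set m := sInf (J '' V)
  have hmle : ∀ h ∈ V, m ≤ J h := fun h hh => csInf_le hbdd ⟨h, hh, rfl⟩
  have hseq : ∀ n : ℕ, ∃ h ∈ V, J h < m + (1 / 4 : ℝ) ^ n / 2 := fun n => by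
    obtain ⟨_, ⟨h, hh, rfl⟩, hlt⟩ := exists_lt_of_csInf_lt (hne.image J)
      (show sInf (J '' V) < m + (1 / 4 : ℝ) ^ n / 2 by
        have : (0 : ℝ) < (1 / 4 : ℝ) ^ n / 2 := by positivity
        linarith)
    exact ⟨h, hh, hlt⟩
  choose u huV hu using hseq
  have hsq : ∀ s t : ℝ, (Real.exp (s / 2) - Real.exp (t / 2)) ^ 2
      = (Real.exp s - s) + (Real.exp t - t)
        - 2 * (Real.exp ((s + t) / 2) - (s + t) / 2) := fun s t => by
    have h1 : Real.exp s = Real.exp (s / 2) ^ 2 := by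
      rw [← Real.exp_nat_mul]; congr 1; push_cast; ring
    have h2 : Real.exp t = Real.exp (t / 2) ^ 2 := by
      rw [← Real.exp_nat_mul]; congr 1; push_cast; ring
    have h3 : Real.exp ((s + t) / 2) = Real.exp (s / 2) * Real.exp (t / 2) := by
      rw [← Real.exp_add]; congr 1; ring
    rw [h1, h2, h3]; ring
  have hsqint : ∀ n k, Integrable
      (fun z => (Real.exp (u n z / 2) - Real.exp (u k z / 2)) ^ 2) μ := fun n k => by
    simp_rw [hsq]
    exact ((hJint _ (huV n)).add (hJint _ (huV k))).sub
      ((hJint _ (hmid _ (huV n) _ (huV k))).const_mul 2)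
  have hsqle : ∀ n k, ∫ z, (Real.exp (u n z / 2) - Real.exp (u k z / 2)) ^ 2 ∂μ
      ≤ J (u n) + J (u k) - 2 * m := fun n k => by
    have hmem := hmid _ (huV n) _ (huV k)
    simp_rw [hsq]
    rw [integral_sub ((hJint _ (huV n)).fun_add (hJint _ (huV k))) ((hJint _ hmem).const_mul 2),
      integral_add (hJint _ (huV n)) (hJint _ (huV k)), integral_const_mul]
    have := hmle _ hmem
    simp only [hJ] at this ⊢
    linarith
  have hmeas : ∀ n, AEStronglyMeasurable (u n) μ := fun n => (hint _ (huV n)).1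
  have hmeas' : ∀ n, AEStronglyMeasurable (fun z => Real.exp (u n z / 2)) μ := fun n =>
    (Real.continuous_exp.comp (continuous_id.div_const 2)).comp_aestronglyMeasurable (hmeas n)
  have hconv : ∀ᵐ z ∂μ, ∃ l : ℝ, Tendsto (fun n => Real.exp (u n z / 2)) atTop (𝓝 l) := by
    refine Lp.ae_tendsto_of_cauchy_eLpNorm (p := 2) (f := fun n z => Real.exp (u n z / 2))
      (B := fun n => ENNReal.ofReal ((1 / 2 : ℝ) ^ n)) hmeas' (by norm_num) ?_ ?_
    · exact (summable_geometric_of_lt_one (by norm_num)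
        (by norm_num : (1 / 2 : ℝ) < 1)).tsum_ofReal_ne_top
    · intro N n k hn hk
      have hlt : ∫ z, (Real.exp (u n z / 2) - Real.exp (u k z / 2)) ^ 2 ∂μ
          < ((1 / 2 : ℝ) ^ N) ^ 2 := by
        have e1 : (1 / 4 : ℝ) ^ n ≤ (1 / 4) ^ N :=
          pow_le_pow_of_le_one (by norm_num) (by norm_num) hn
        have e2 : (1 / 4 : ℝ) ^ k ≤ (1 / 4) ^ N :=
          pow_le_pow_of_le_one (by norm_num) (by norm_num) hk
        have e3 : ((1 / 2 : ℝ) ^ N) ^ 2 = (1 / 4) ^ N := by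
          rw [← pow_mul, mul_comm, pow_mul]; norm_num
        linarith [hsqle n k, hu n, hu k]
      have hmem : MemLp ((fun z => Real.exp (u n z / 2)) - fun z => Real.exp (u k z / 2)) 2 μ :=
        (memLp_two_iff_integrable_sq ((hmeas' n).sub (hmeas' k))).2 (hsqint n k)
      rw [hmem.eLpNorm_eq_integral_rpow_norm (by norm_num) (by norm_num)]
      refine (ENNReal.ofReal_lt_ofReal_iff (by positivity)).2 ?_
      have hnorm : ∀ z, ‖((fun z => Real.exp (u n z / 2)) - fun z => Real.exp (u k z / 2)) z‖
          ^ (2 : ENNReal).toReal = (Real.exp (u n z / 2) - Real.exp (u k z / 2)) ^ 2 := fun z => by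
        simp
      simp_rw [hnorm]
      have h2 : ((2 : ENNReal).toReal)⁻¹ = (1 / 2 : ℝ) := by simp
      rw [h2, ← Real.sqrt_eq_rpow]
      exact (Real.sqrt_lt' (by positivity)).2 hlt
  have hJlim : Tendsto (fun n => J (u n)) atTop (𝓝 m) := by
    have hpow : Tendsto (fun n : ℕ => m + (1 / 4 : ℝ) ^ n / 2) atTop (𝓝 (m + 0 / 2)) :=
      ((tendsto_pow_atTop_nhds_zero_of_lt_one (by norm_num) (by norm_num)).div_const
        2).const_add m
    rw [zero_div, add_zero] at hpow
    exact tendsto_of_tendsto_of_tendsto_of_le_of_le tendsto_const_nhds hpow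
      (fun n => hmle _ (huV n)) fun n => (hu n).le
  set F : ℕ → Ω → ENNReal := fun n z => ENNReal.ofReal (Real.exp (u n z) - u n z)
  have hFmeas : ∀ n, AEMeasurable (F n) μ := fun n =>
    (hJint _ (huV n)).1.aemeasurable.ennreal_ofReal
  have hFatou : ∫⁻ z, liminf (fun n => F n z) atTop ∂μ ≤ ENNReal.ofReal m := by
    refine (lintegral_liminf_le' hFmeas).trans_eq ?_
    have : (fun n => ∫⁻ z, F n z ∂μ) = fun n => ENNReal.ofReal (J (u n)) := by
      funext n
      exact (ofReal_integral_eq_lintegral_ofReal (hJint _ (huV n))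
        (Eventually.of_forall fun z => hpos _)).symm
    rw [this]
    exact (ENNReal.tendsto_ofReal hJlim).liminf_eq
  have hliminf : AEMeasurable (fun z => liminf (fun n => F n z) atTop) μ :=
    ⟨_, Measurable.liminf fun n => (hFmeas n).measurable_mk, by
      filter_upwards [ae_all_iff.2 fun n => (hFmeas n).ae_eq_mk] with z hz
      exact congrArg (fun v => liminf v atTop) (funext hz)⟩
  have hfin : ∀ᵐ z ∂μ, liminf (fun n => F n z) atTop < ⊤ :=
    ae_lt_top' hliminf (hFatou.trans_lt ENNReal.ofReal_lt_top).ne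
  have hlim : ∀ᵐ z ∂μ, ∃ l : ℝ, Tendsto (fun n => u n z) atTop (𝓝 l) := by
    filter_upwards [hconv, hfin] with z ⟨l, hl⟩ hz
    have hl0 : 0 ≤ l := ge_of_tendsto' hl fun n => (Real.exp_pos _).le
    rcases hl0.eq_or_lt with rfl | hl0
    · exfalso
      have hbot : Tendsto (fun n => u n z / 2) atTop atBot := Real.tendsto_exp_comp_nhds_zero.1 hl
      have htop : Tendsto (fun n => Real.exp (u n z) - u n z) atTop atTop := by
        refine tendsto_atTop_mono (fun n => ?_) (tendsto_neg_atBot_atTop.comp hbot |>.const_mul_atTop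
          (zero_lt_two' ℝ))
        simp only [Function.comp]
        linarith [Real.exp_pos (u n z)]
      have := (ENNReal.tendsto_ofReal_atTop.comp htop).liminf_eq
      exact hz.ne this
    · refine ⟨2 * Real.log l, ?_⟩
      have := ((Real.continuousAt_log hl0.ne').tendsto.comp hl).const_mul 2
      refine this.congr fun n => ?_
      simp only [Function.comp, Real.log_exp]
      ring
  obtain ⟨h, hhm, hh⟩ := measurable_limit_of_tendsto_metrizable_ae
    (fun n => (hmeas n).aemeasurable) hlim
  have hhexp : Measurable fun z => Real.exp (h z) - h z := hhm.exp.sub hhm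
  have hle : ∫⁻ z, ENNReal.ofReal (Real.exp (h z) - h z) ∂μ ≤ ENNReal.ofReal m := by
    refine le_trans (le_of_eq (lintegral_congr_ae ?_)) hFatou
    filter_upwards [hh] with z hz
    exact (ENNReal.tendsto_ofReal
      (((Real.continuous_exp.tendsto _).comp hz).sub hz)).liminf_eq.symm
  have hI : Integrable (fun z => Real.exp (h z) - h z) μ := by
    refine ⟨hhexp.aestronglyMeasurable, ?_⟩
    rw [hasFiniteIntegral_iff_ofReal (Eventually.of_forall fun z => hpos _)]
    exact hle.trans_lt ENNReal.ofReal_lt_top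
  have hIh : Integrable h μ := by
    refine hI.mono' hhm.aestronglyMeasurable (Eventually.of_forall fun z => ?_)
    rw [Real.norm_eq_abs, abs_le]
    refine ⟨by linarith [Real.exp_pos (h z)], ?_⟩
    have h1 := Real.add_one_le_exp (h z / 2)
    have h2 : Real.exp (h z) = Real.exp (h z / 2) ^ 2 := by
      rw [← Real.exp_nat_mul]; congr 1; push_cast; ring
    rcases le_or_gt (h z) 0 with h0 | h0
    · linarith [Real.exp_pos (h z)]
    · nlinarith [sq_nonneg (h z / 2 - 1)]
  refine ⟨u, h, huV, hIh, ?_, hh, fun g hg => ?_⟩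
  · simpa using hI.fun_add hIh
  · refine le_trans ?_ (hmle g hg)
    rw [integral_eq_lintegral_of_nonneg_ae (Eventually.of_forall fun z => hpos _)
      hhexp.aestronglyMeasurable]
    exact ENNReal.toReal_le_of_le_ofReal
      (le_csInf (hne.image J) (by rintro _ ⟨h, -, rfl⟩; exact integral_nonneg fun z => hpos _)) hle

/-- An a.e. limit of functions of the form `a x + c y` on a product space is again of this form. -/
theorem exists_ae_eq_add_of_ae_tendsto {X Y : Type*} [MeasurableSpace X] [MeasurableSpace Y]
    {μ : Measure X} {ν : Measure Y} [IsProbabilityMeasure μ] [IsProbabilityMeasure ν]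
    {a : ℕ → X → ℝ} {c : ℕ → Y → ℝ} (ha : ∀ n, AEMeasurable (a n) μ)
    (hc : ∀ n, AEMeasurable (c n) ν) {g : X × Y → ℝ}
    (hg : ∀ᵐ z ∂μ.prod ν, Tendsto (fun n => a n z.1 + c n z.2) atTop (𝓝 (g z))) :
    ∃ (a' : X → ℝ) (c' : Y → ℝ), Measurable a' ∧ Measurable c' ∧
      ∀ᵐ z ∂μ.prod ν, g z = a' z.1 + c' z.2 := by
  have h1 := Measure.ae_ae_of_ae_prod hg
  obtain ⟨x₁, hx₁⟩ := h1.exists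
  have hg' : ∀ᵐ z ∂ν.prod μ, Tendsto (fun n => a n z.2 + c n z.1) atTop (𝓝 (g z.swap)) :=
    Measure.measurePreserving_swap.quasiMeasurePreserving.ae hg
  obtain ⟨y₁, hy₁, hy₁'⟩ := (hx₁.and (Measure.ae_ae_of_ae_prod hg')).exists
  obtain ⟨a', ha'm, ha'⟩ := measurable_limit_of_tendsto_metrizable_ae
    (fun n => (ha n).add_const (c n y₁)) (hy₁'.mono fun x hx => ⟨_, hx⟩)
  obtain ⟨c', hc'm, hc'⟩ := measurable_limit_of_tendsto_metrizable_ae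
    (fun n => (hc n).sub_const (c n y₁)) (hx₁.mono fun y hy => ⟨_, by
      refine (hy.sub hy₁).congr fun n => ?_
      change a n x₁ + c n y - (a n x₁ + c n y₁) = c n y - c n y₁
      ring⟩)
  refine ⟨a', c', ha'm, hc'm, ?_⟩
  filter_upwards [hg, Measure.quasiMeasurePreserving_fst.ae ha',
    Measure.quasiMeasurePreserving_snd.ae hc'] with z hz hz1 hz2
  refine tendsto_nhds_unique hz ((hz1.add hz2).congr fun n => ?_)
  ring

/-- If `a x + c y` is integrable on a product of probability spaces, then so is `a`. -/
theorem integrable_left_of_integrable_add {X Y : Type*} [MeasurableSpace X] [MeasurableSpace Y]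
    {μ : Measure X} {ν : Measure Y} [IsProbabilityMeasure μ] [IsProbabilityMeasure ν]
    {a : X → ℝ} {c : Y → ℝ} (h : Integrable (fun z : X × Y => a z.1 + c z.2) (μ.prod ν)) :
    Integrable a μ := by
  obtain ⟨y, hy⟩ := h.prod_left_ae.exists
  exact integrable_add_const_iff (c := c y).1 hy

/-- If `a x + c y` is integrable on a product of probability spaces, then so is `c`. -/
theorem integrable_right_of_integrable_add {X Y : Type*} [MeasurableSpace X] [MeasurableSpace Y]
    {μ : Measure X} {ν : Measure Y} [IsProbabilityMeasure μ] [IsProbabilityMeasure ν]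
    {a : X → ℝ} {c : Y → ℝ} (h : Integrable (fun z : X × Y => a z.1 + c z.2) (μ.prod ν)) :
    Integrable c ν := by
  obtain ⟨x, hx⟩ := h.prod_right_ae.exists
  exact (integrable_add_iff_integrable_right' (integrable_const (a x))).1 hx

theorem eq_of_forall_mul_le_exp_sub_one_mul {p q : ℝ}
    (h : ∀ t : ℝ, t * p ≤ (Real.exp t - 1) * q) : q = p := by
  have hd : HasDerivAt (fun t => (Real.exp t - 1) * q - t * p) (Real.exp 0 * q - 1 * p) 0 :=
    (((Real.hasDerivAt_exp 0).sub_const 1).mul_const q).sub ((hasDerivAt_id (0 : ℝ)).mul_const p)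
  have hmin : IsLocalMin (fun t => (Real.exp t - 1) * q - t * p) 0 :=
    Eventually.of_forall fun t => by simpa using h t
  have := hmin.hasDerivAt_eq_zero hd
  simp only [Real.exp_zero, one_mul] at this
  linarith

theorem exp_add_indicator {Ω : Type*} (h : Ω → ℝ) (s : Set Ω) (t : ℝ) (z : Ω) :
    Real.exp (h z + s.indicator (fun _ => t) z)
      = Real.exp (h z) + (Real.exp t - 1) * s.indicator (fun z => Real.exp (h z)) z := by
  by_cases hz : z ∈ s
  · simp [hz, Real.exp_add]; ring
  · simp [hz]

theorem integrable_exp_add_indicator {Ω : Type*} [MeasurableSpace Ω] {μ : Measure Ω}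
    {h : Ω → ℝ} (hexp : Integrable (fun z => Real.exp (h z)) μ) {s : Set Ω}
    (hs : MeasurableSet s) (t : ℝ) :
    Integrable (fun z => Real.exp (h z + s.indicator (fun _ => t) z)) μ := by
  simp_rw [exp_add_indicator]
  exact hexp.add ((hexp.indicator hs).const_mul _)

/-- First-order optimality condition for `h ↦ ∫ (exp h - h)` in the direction of an indicator. -/
theorem withDensity_exp_apply_of_minimizer {Ω : Type*} [MeasurableSpace Ω] {μ : Measure Ω}
    [IsFiniteMeasure μ] {h : Ω → ℝ} (hint : Integrable h μ)
    (hexp : Integrable (fun z => Real.exp (h z)) μ) {s : Set Ω} (hs : MeasurableSet s)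
    (hmin : ∀ t : ℝ, ∫ z, (Real.exp (h z) - h z) ∂μ ≤
      ∫ z, (Real.exp (h z + s.indicator (fun _ => t) z) - (h z + s.indicator (fun _ => t) z)) ∂μ) :
    μ.withDensity (fun z => ENNReal.ofReal (Real.exp (h z))) s = μ s := by
  have key : ∫ z in s, Real.exp (h z) ∂μ = μ.real s := by
    refine eq_of_forall_mul_le_exp_sub_one_mul fun t => ?_
    have hti : Integrable (s.indicator fun _ => t) μ := (integrable_const t).indicator hs
    have := hmin t
    rw [integral_sub (integrable_exp_add_indicator hexp hs t) (hint.fun_add hti),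
      integral_add hint hti, integral_sub hexp hint] at this
    simp_rw [exp_add_indicator] at this
    rw [integral_add hexp ((hexp.indicator hs).const_mul _), integral_const_mul,
      integral_indicator hs, integral_indicator hs, setIntegral_const, smul_eq_mul] at this
    linarith
  rw [withDensity_apply _ hs, ← ofReal_integral_eq_lintegral_ofReal hexp.integrableOn
    (Eventually.of_forall fun z => (Real.exp_pos _).le), key]
  simp

/-- Theorem 2 (Existence) of Osius, *Asymptotic inference for semiparametric
association models*, direction (c) ⇒ (a): under Conditions (OR1), (E1) and (E2) there is
a probability measure `P` with marginals `π_X`, `π_Y`, finite Kullback–Leibler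
divergence `I(π_X × π_Y | P)` and log-odds ratio function `ψ`; its density w.r.t.
`π = π_X × π_Y` has the form `exp(a(x) + c(y) + ψ(x,y))`. -/
theorem existence_of_association
    {ΩX ΩY : Type*} [MeasurableSpace ΩX] [MeasurableSpace ΩY]
    (x₀ : ΩX) (y₀ : ΩY)
    (πX : Measure ΩX) [IsProbabilityMeasure πX]
    (πY : Measure ΩY) [IsProbabilityMeasure πY]
    (ψ : ΩX × ΩY → ℝ) (hψ_meas : Measurable ψ)
    -- Condition (OR1)
    (hψ_x : ∀ x, ψ (x, y₀) = 0) (hψ_y : ∀ y, ψ (x₀, y) = 0)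
    -- Condition (E1)
    (hψ_int : Integrable ψ (πX.prod πY))
    -- Condition (E2)
    (β : ΩX → ℝ) (hβ_int : Integrable β πX)
    (γ : ΩY → ℝ) (hγ_int : Integrable γ πY)
    (hE2 : Integrable (fun z : ΩX × ΩY => Real.exp (ψ z - β z.1 - γ z.2)) (πX.prod πY)) :
    ∃ a : ΩX → ℝ, ∃ c : ΩY → ℝ, Measurable a ∧ Measurable c ∧
      (IsProbabilityMeasure ((πX.prod πY).withDensity
          (fun z => ENNReal.ofReal (Real.exp (a z.1 + c z.2 + ψ z))))) ∧
      (((πX.prod πY).withDensity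
          (fun z => ENNReal.ofReal (Real.exp (a z.1 + c z.2 + ψ z)))).map Prod.fst = πX) ∧
      (((πX.prod πY).withDensity
          (fun z => ENNReal.ofReal (Real.exp (a z.1 + c z.2 + ψ z)))).map Prod.snd = πY) ∧
      -- finiteness of the Kullback–Leibler divergence I(π | P):
      -- log (dπ/dP) = −(a(x) + c(y) + ψ(x,y)) is π-integrable
      Integrable (fun z : ΩX × ΩY => a z.1 + c z.2 + ψ z) (πX.prod πY) ∧
      -- P and π = P^X × P^Y dominate each other
      (((πX.prod πY).withDensity
          (fun z => ENNReal.ofReal (Real.exp (a z.1 + c z.2 + ψ z)))) ≪ πX.prod πY) ∧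
      (πX.prod πY ≪ ((πX.prod πY).withDensity
          (fun z => ENNReal.ofReal (Real.exp (a z.1 + c z.2 + ψ z))))) ∧
      -- the odds ratio function of the density equals exp ∘ ψ
      (∀ z, oddsRatioFn (fun w => Real.exp (a w.1 + c w.2 + ψ w)) x₀ y₀ z
          = Real.exp (ψ z)) := by
  set V : Set (ΩX × ΩY → ℝ) := {h | ∃ (a : ΩX → ℝ) (c : ΩY → ℝ), Integrable a πX ∧
    Integrable c πY ∧ (h = fun z => a z.1 + c z.2 + ψ z) ∧
    Integrable (fun z => Real.exp (h z)) (πX.prod πY)}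
  have hVint : ∀ h ∈ V, Integrable h (πX.prod πY) := by
    rintro _ ⟨a, c, ha, hc, rfl, -⟩
    exact ((ha.comp_fst πY).add (hc.comp_snd πX)).add hψ_int
  have hne : V.Nonempty := by
    refine ⟨_, fun x => -β x, fun y => -γ y, hβ_int.neg, hγ_int.neg, rfl, ?_⟩
    refine hE2.congr (Eventually.of_forall fun z => ?_)
    change Real.exp _ = Real.exp _
    congr 1
    ring
  have hmid : ∀ f ∈ V, ∀ g ∈ V, (fun z => (f z + g z) / 2) ∈ V := by
    intro f hf g hg
    have hfg := ((hVint f hf).add (hVint g hg)).div_const 2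
    obtain ⟨a, c, ha, hc, hf', hfe⟩ := hf
    obtain ⟨a', c', ha', hc', hg', hge⟩ := hg
    refine ⟨fun x => (a x + a' x) / 2, fun y => (c y + c' y) / 2, (ha.add ha').div_const 2,
      (hc.add hc').div_const 2, ?_, ?_⟩
    · funext z
      rw [hf', hg']
      ring
    · refine (hfe.add hge).mono'
        (Real.continuous_exp.comp_aestronglyMeasurable hfg.1) (Eventually.of_forall fun z => ?_)
      rw [Real.norm_eq_abs, abs_of_pos (Real.exp_pos _)]
      change Real.exp ((f z + g z) / 2) ≤ Real.exp (f z) + Real.exp (g z)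
      rcases le_total (f z) (g z) with h | h
      · linarith [Real.exp_le_exp.2 (show (f z + g z) / 2 ≤ g z by linarith), Real.exp_pos (f z)]
      · linarith [Real.exp_le_exp.2 (show (f z + g z) / 2 ≤ f z by linarith), Real.exp_pos (g z)]
  obtain ⟨u, h, huV, hh, hhe, hlim, hmin⟩ :=
    exists_ae_tendsto_minimizer hne hVint (fun h ⟨_, _, _, _, _, he⟩ => he) hmid
  choose a c ha hc huac _ using huV
  obtain ⟨a', c', ha'm, hc'm, hac⟩ := exists_ae_eq_add_of_ae_tendsto
    (g := fun z => h z - ψ z) (fun n => (ha n).1.aemeasurable) (fun n => (hc n).1.aemeasurable) (by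
      filter_upwards [hlim] with z hz
      refine (hz.sub_const (ψ z)).congr fun n => ?_
      rw [huac n]
      ring)
  have hheq : h =ᵐ[πX.prod πY] fun z => a' z.1 + c' z.2 + ψ z := by
    filter_upwards [hac] with z hz
    linarith
  have hacint : Integrable (fun z : ΩX × ΩY => a' z.1 + c' z.2) (πX.prod πY) :=
    (hh.sub hψ_int).congr hac
  have ha' : Integrable a' πX := integrable_left_of_integrable_add hacint
  have hc' : Integrable c' πY := integrable_right_of_integrable_add hacint
  have hint : Integrable (fun z : ΩX × ΩY => a' z.1 + c' z.2 + ψ z) (πX.prod πY) := hh.congr hheq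
  have hexp : Integrable (fun z : ΩX × ΩY => Real.exp (a' z.1 + c' z.2 + ψ z)) (πX.prod πY) :=
    hhe.congr (hheq.fun_comp Real.exp)
  have hmin' : ∀ g ∈ V, ∫ z, (Real.exp (a' z.1 + c' z.2 + ψ z) - (a' z.1 + c' z.2 + ψ z))
      ∂πX.prod πY ≤ ∫ z, (Real.exp (g z) - g z) ∂πX.prod πY := fun g hg =>
    (integral_congr_ae (hheq.fun_comp fun t => Real.exp t - t)).symm.trans_le (hmin g hg)
  set P := (πX.prod πY).withDensity
    (fun z => ENNReal.ofReal (Real.exp (a' z.1 + c' z.2 + ψ z)))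
  have hfst : P.map Prod.fst = πX := by
    ext s hs
    rw [Measure.map_apply measurable_fst hs,
      withDensity_exp_apply_of_minimizer hint hexp (measurable_fst hs) fun t => hmin' _
        ⟨fun x => a' x + s.indicator (fun _ => t) x, c',
          ha'.add ((integrable_const t).indicator hs), hc', ?_,
          integrable_exp_add_indicator hexp (measurable_fst hs) t⟩,
      ← Measure.map_apply measurable_fst hs, Measure.map_fst_prod]
    · simp
    · funext z
      change _ = a' z.1 + s.indicator (fun _ => t) z.1 + c' z.2 + ψ z
      rw [show (Prod.fst ⁻¹' s).indicator (fun _ => t) z = s.indicator (fun _ => t) z.1 from rfl]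
      ring
  have hsnd : P.map Prod.snd = πY := by
    ext s hs
    rw [Measure.map_apply measurable_snd hs,
      withDensity_exp_apply_of_minimizer hint hexp (measurable_snd hs) fun t => hmin' _
        ⟨a', fun y => c' y + s.indicator (fun _ => t) y, ha',
          hc'.add ((integrable_const t).indicator hs), ?_,
          integrable_exp_add_indicator hexp (measurable_snd hs) t⟩,
      ← Measure.map_apply measurable_snd hs, Measure.map_snd_prod]
    · simp
    · funext z
      change _ = a' z.1 + (c' z.2 + s.indicator (fun _ => t) z.2) + ψ z
      rw [show (Prod.snd ⁻¹' s).indicator (fun _ => t) z = s.indicator (fun _ => t) z.2 from rfl]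
      ring
  refine ⟨a', c', ha'm, hc'm, ⟨?_⟩, hfst, hsnd, hint, withDensity_absolutelyContinuous _ _,
    withDensity_absolutelyContinuous' hexp.1.aemeasurable.ennreal_ofReal
      (Eventually.of_forall fun z => by simp [Real.exp_pos]), fun z => ?_⟩
  · rw [← Set.preimage_univ (f := Prod.fst), ← Measure.map_apply measurable_fst .univ, hfst]
    exact measure_univ
  · simp only [oddsRatioFn, hψ_x, hψ_y, ← Real.exp_add, ← Real.exp_sub]
    congr 1
    ring
end
end

section
/- Let P be a probability measure on Ω = Ω_X × Ω_Y with marginals π_X and π_Y, such that P and π = π_X × π_Y are mutually absolutely continuous with an everywhere positive density version p = dP/dπ for which log p is π-integrable. Fix reference points x° ∈ Ω_X, y° ∈ Ω_Y such that x ↦ log p(x,y°) is π_X-integrable and y ↦ log p(x°,y) is π_Y-integrable, and set ψ(x,y) = log OR_p(x,y). Then: (i) ψ(x,y°) = 0 and ψ(x°,y) = 0 for all x, y; (ii) ψ is π-integrable; and (iii) with the π_X-integrable function β(x) = −log p(x,y°) and the π_Y-integrable function γ(y) = −log p(x°,y), one has ∫ exp(ψ(x,y) − β(x) − γ(y)) dπ(x,y)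 = p(x°,y°) < ∞. -/
open MeasureTheory

noncomputable section

/-- Theorem 2 of Osius, direction (b) ⇒ (c) (necessity): if `P ∈ 𝒫_f` has positive
density `p` w.r.t. `π = π_X × π_Y` with `log p` integrable, then
`ψ = log OR_p` satisfies Conditions (OR1), (E1) and (E2), the latter with
`β(x) = −log p(x,y°)`, `γ(y) = −log p(x°,y)` and
`∫ exp(ψ − β − γ) dπ = p(x°,y°)`. -/
theorem necessity_of_conditions
    {ΩX ΩY : Type*} [MeasurableSpace ΩX] [MeasurableSpace ΩY]
    (x₀ : ΩX) (y₀ : ΩY)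
    (πX : Measure ΩX) [IsProbabilityMeasure πX]
    (πY : Measure ΩY) [IsProbabilityMeasure πY]
    (P : Measure (ΩX × ΩY)) [IsProbabilityMeasure P]
    (hPX : P.map Prod.fst = πX) (hPY : P.map Prod.snd = πY)
    (p : ΩX × ΩY → ℝ) (hp_meas : Measurable p) (hp_pos : ∀ z, 0 < p z)
    (hp_dens : P = (πX.prod πY).withDensity (fun z => ENNReal.ofReal (p z)))
    (hp_logint : Integrable (fun z => Real.log (p z)) (πX.prod πY))
    (hβ_int : Integrable (fun x => Real.log (p (x, y₀))) πX)
    (hγ_int : Integrable (fun y => Real.log (p (x₀, y))) πY) :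
    -- (i) Condition (OR1) for ψ = log OR_p
    (∀ x, Real.log (oddsRatioFn p x₀ y₀ (x, y₀)) = 0) ∧
    (∀ y, Real.log (oddsRatioFn p x₀ y₀ (x₀, y)) = 0) ∧
    -- (ii) Condition (E1): ψ is π-integrable
    Integrable (fun z => Real.log (oddsRatioFn p x₀ y₀ z)) (πX.prod πY) ∧
    -- (iii) Condition (E2) with β(x) = −log p(x,y°), γ(y) = −log p(x°,y)
    Integrable (fun x => -Real.log (p (x, y₀))) πX ∧
    Integrable (fun y => -Real.log (p (x₀, y))) πY ∧
    Integrable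
      (fun z : ΩX × ΩY => Real.exp (Real.log (oddsRatioFn p x₀ y₀ z)
        - (-Real.log (p (z.1, y₀))) - (-Real.log (p (x₀, z.2))))) (πX.prod πY) ∧
    ∫ z, Real.exp (Real.log (oddsRatioFn p x₀ y₀ z)
        - (-Real.log (p (z.1, y₀))) - (-Real.log (p (x₀, z.2)))) ∂(πX.prod πY)
      = p (x₀, y₀) := by
  have log_oddsRatio (z : ΩX × ΩY) : Real.log (oddsRatioFn p x₀ y₀ z) =
      Real.log (p z) + Real.log (p (x₀, y₀))
        - (Real.log (p (z.1, y₀)) + Real.log (p (x₀, z.2))) := by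
    have hne := fun w => (hp_pos w).ne'
    rw [oddsRatioFn, Real.log_div (mul_ne_zero (hne _) (hne _)) (mul_ne_zero (hne _) (hne _)),
      Real.log_mul (hne _) (hne _), Real.log_mul (hne _) (hne _)]
  have exp_eq (z : ΩX × ΩY) : Real.exp (Real.log (oddsRatioFn p x₀ y₀ z)
      - (-Real.log (p (z.1, y₀))) - (-Real.log (p (x₀, z.2)))) = p z * p (x₀, y₀) := by
    rw [log_oddsRatio, ← Real.exp_log (hp_pos z), ← Real.exp_log (hp_pos (x₀, y₀)),
      ← Real.exp_add]
    simp only [Real.log_exp]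
    ring_nf
  have hp_lintegral : ∫⁻ z, ENNReal.ofReal (p z) ∂(πX.prod πY) = 1 := by
    rw [← setLIntegral_univ, ← withDensity_apply _ MeasurableSet.univ, ← hp_dens, measure_univ]
  have hp_nonneg : 0 ≤ᵐ[πX.prod πY] p := ae_of_all _ fun z => (hp_pos z).le
  have hp_int : Integrable p (πX.prod πY) :=
    (lintegral_ofReal_ne_top_iff_integrable hp_meas.aestronglyMeasurable hp_nonneg).1
      (by simp [hp_lintegral])
  have hp_integral : ∫ z, p z ∂(πX.prod πY) = 1 := by
    rw [integral_eq_lintegral_of_nonneg_ae hp_nonneg hp_meas.aestronglyMeasurable,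
      hp_lintegral, ENNReal.toReal_one]
  simp only [exp_eq]
  refine ⟨fun x => ?_, fun y => ?_, ?_, hβ_int.neg, hγ_int.neg, hp_int.mul_const _, ?_⟩
  · rw [log_oddsRatio]
    ring
  · rw [log_oddsRatio]
    ring
  · simp only [log_oddsRatio]
    exact (hp_logint.add (integrable_const _)).sub
      ((hβ_int.comp_fst πY).add (hγ_int.comp_snd πX))
  · rw [integral_mul_const, hp_integral, one_mul]
end
end

section
/- Assume θ ↦ ψ(x,k,θ) is continuous for every x and k, and that there is a measurable ψ̃ : Ω → [0,∞) with |ψ(x,k,θ)| ≤ ψ̃(x)·‖θ‖ for all x,k,θ and ∫ ψ̃ dμ_k < ∞ for every k (Conditions (OR2) and (C2)). Then for every k ∈ {0,…,K} and every λ ∈ ℝ^S × ℝ^K, lim_{ε→0⁺} ∫ sup_{‖λ' − λ‖ ≤ ε} η_k(x;λ') dμ_k(x) = ∫ η_k(x;λ) dμ_k(x), all the integrals being finite. -/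
open MeasureTheory ProbabilityTheory Real Filter Finset Metric

noncomputable section

/-- Parameter space: `θ ∈ ℝ^S`, `γ ∈ ℝ^K`. -/
abbrev Param (S K : ℕ) : Type := (Fin S → ℝ) × (Fin K → ℝ)

/-- Extend `γ ∈ ℝ^K` to `Fin (K+1) → ℝ` with `γ_0 = 0`. -/
def gamFull {K : ℕ} (γ : Fin K → ℝ) : Fin (K + 1) → ℝ := Fin.cases 0 γ

/-- `p_k(x;λ) = exp(γ_k + ψ(x,k,θ)) / Σ_l exp(γ_l + ψ(x,l,θ))`. -/
def pfun {Ω : Type*} {S K : ℕ} (ψ : Ω → Fin (K + 1) → (Fin S → ℝ) → ℝ)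
    (k : Fin (K + 1)) (x : Ω) (lam : Param S K) : ℝ :=
  Real.exp (gamFull lam.2 k + ψ x k lam.1) /
    ∑ l : Fin (K + 1), Real.exp (gamFull lam.2 l + ψ x l lam.1)

/-- `η_k(x;λ) = log p_k(x;λ)`. -/
def eta {Ω : Type*} {S K : ℕ} (ψ : Ω → Fin (K + 1) → (Fin S → ℝ) → ℝ)
    (k : Fin (K + 1)) (x : Ω) (lam : Param S K) : ℝ :=
  Real.log (pfun ψ k x lam)

/-- The `i`-th standard basis vector of the parameter space
(the `S` θ-coordinates come first, then the `K` γ-coordinates). -/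
def basisVec (S K : ℕ) (i : Fin (S + K)) : Param S K :=
  Fin.addCases (fun s => (Pi.single s 1, 0)) (fun g => (0, Pi.single g 1)) i

/-- Partial derivative `∂_{λ_i} f(λ)`. -/
def pd {S K : ℕ} (f : Param S K → ℝ) (lam : Param S K) (i : Fin (S + K)) : ℝ :=
  fderiv ℝ f lam (basisVec S K i)

/-- Second partial derivative `∂²_{λ_i λ_j} f(λ)`. -/
def pd2 {S K : ℕ} (f : Param S K → ℝ) (lam : Param S K) (i j : Fin (S + K)) : ℝ :=
  fderiv ℝ (fun l => fderiv ℝ f l (basisVec S K i)) lam (basisVec S K j)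

/-- Third partial derivative `∂³_{λ_i λ_j λ_k} f(λ)`. -/
def pd3 {S K : ℕ} (f : Param S K → ℝ) (lam : Param S K) (i j k : Fin (S + K)) : ℝ :=
  fderiv ℝ (fun l => pd2 f l i j) lam (basisVec S K k)

/-- The probability measure `μ_k` with `ν`-density `q_k`. -/
def densMeasure {Ω : Type*} [MeasurableSpace Ω] (ν : Measure Ω) {K : ℕ}
    (q : Fin (K + 1) → Ω → ℝ) (k : Fin (K + 1)) : Measure Ω :=
  ν.withDensity (fun x => ENNReal.ofReal (q k x))

section ClosedBallSup

variable {Ω E : Type*} [MeasurableSpace Ω] [PseudoMetricSpace E]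

theorem measurable_iSup_closedBall [SecondCountableTopology E] {f : Ω → E → ℝ}
    (hf_meas : ∀ y, Measurable fun x => f x y) (hf_cont : ∀ x, Continuous (f x))
    (c : E) (ε : ℝ) :
    Measurable fun x => ⨆ y : closedBall c ε, f x y := by
  obtain ⟨s, hs_count, hs_dense⟩ := TopologicalSpace.exists_countable_dense (closedBall c ε)
  have := hs_count.to_subtype
  have key : (fun x => ⨆ y : closedBall c ε, f x y) =
      fun x => ⨆ y : s, f x (y : closedBall c ε) := by
    funext x
    exact (hs_dense.ciSup' ((hf_cont x).comp continuous_subtype_val)).symm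
  rw [key]
  exact Measurable.iSup fun y => hf_meas _

theorem abs_iSup_closedBall_le {g : E → ℝ} {c : E} {ε b : ℝ} (hε : 0 ≤ ε)
    (hg : ∀ y ∈ closedBall c ε, |g y| ≤ b) :
    |⨆ y : closedBall c ε, g y| ≤ b := by
  have hne : Nonempty (closedBall c ε) := ⟨⟨c, mem_closedBall_self hε⟩⟩
  have hbdd : BddAbove (Set.range fun y : closedBall c ε => g y) :=
    ⟨b, Set.forall_mem_range.2 fun y => (abs_le.1 (hg y y.2)).2⟩
  exact abs_le.2 ⟨(abs_le.1 (hg c (mem_closedBall_self hε))).1.trans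
    (le_ciSup hbdd ⟨c, mem_closedBall_self hε⟩), ciSup_le fun y => (abs_le.1 (hg y y.2)).2⟩

theorem tendsto_iSup_closedBall {g : E → ℝ} {c : E} (hg : ContinuousAt g c) :
    Tendsto (fun ε : ℝ => ⨆ y : closedBall c ε, g y) (nhdsWithin 0 (Set.Ioi 0)) (nhds (g c)) := by
  refine Metric.tendsto_nhds.2 fun δ hδ => ?_
  obtain ⟨ρ, hρ, hgρ⟩ := Metric.continuousAt_iff.1 hg (δ / 2) (half_pos hδ)
  filter_upwards [Ioo_mem_nhdsGT hρ] with ε hε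
  have hmem : c ∈ closedBall c ε := mem_closedBall_self hε.1.le
  have hne : Nonempty (closedBall c ε) := ⟨⟨c, hmem⟩⟩
  have hclose (y : closedBall c ε) : g y ≤ g c + δ / 2 := by
    have := (abs_lt.1 (hgρ ((mem_closedBall.1 y.2).trans_lt hε.2))).2
    linarith
  have hle : ⨆ y : closedBall c ε, g y ≤ g c + δ / 2 := ciSup_le hclose
  have hge : g c ≤ ⨆ y : closedBall c ε, g y :=
    le_ciSup (f := fun y : closedBall c ε => g y)
      ⟨_, Set.forall_mem_range.2 hclose⟩ ⟨c, hmem⟩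
  rw [Real.dist_eq, abs_lt]
  constructor <;> linarith

/-- Local domination suffices for the integral of the supremum over a shrinking closed ball to
converge to the integral at the centre. -/
theorem tendsto_integral_iSup_closedBall [SecondCountableTopology E] {μ : Measure Ω}
    {f : Ω → E → ℝ} (hf_meas : ∀ y, Measurable fun x => f x y) (hf_cont : ∀ x, Continuous (f x))
    {c : E} {ρ : ℝ} (hρ : 0 < ρ) {bound : Ω → ℝ} (hbound : Integrable bound μ)
    (hf_bound : ∀ x, ∀ y ∈ closedBall c ρ, |f x y| ≤ bound x) :
    Tendsto (fun ε : ℝ => ∫ x, ⨆ y : closedBall c ε, f x y ∂μ)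
      (nhdsWithin 0 (Set.Ioi 0)) (nhds (∫ x, f x c ∂μ)) := by
  refine tendsto_integral_filter_of_dominated_convergence bound
    (.of_forall fun ε => (measurable_iSup_closedBall hf_meas hf_cont c ε).aestronglyMeasurable)
    ?_ hbound (.of_forall fun x => tendsto_iSup_closedBall (hf_cont x).continuousAt)
  filter_upwards [Ioc_mem_nhdsGT hρ] with ε hε
  exact .of_forall fun x => abs_iSup_closedBall_le hε.1.le fun y hy =>
    hf_bound x y (closedBall_subset_closedBall hε.2 hy)

end ClosedBallSup

theorem abs_log_exp_div_sum_exp_le {ι : Type*} [Fintype ι] {a : ι → ℝ} {M : ℝ}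
    (ha : ∀ i, |a i| ≤ M) (k : ι) :
    |Real.log (Real.exp (a k) / ∑ i, Real.exp (a i))| ≤ Real.log (Fintype.card ι) + 2 * M := by
  have hcard : (0 : ℝ) < Fintype.card ι := by
    have : Nonempty ι := ⟨k⟩
    exact_mod_cast Fintype.card_pos
  have hpos : 0 < ∑ i, Real.exp (a i) := Finset.sum_pos (fun i _ => Real.exp_pos _) ⟨k, mem_univ k⟩
  have hak := abs_le.1 (ha k)
  have hlower : a k ≤ Real.log (∑ i, Real.exp (a i)) :=
    (Real.le_log_iff_exp_le hpos).2 <|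
      Finset.single_le_sum (f := fun i => Real.exp (a i)) (fun i _ => (Real.exp_pos _).le)
        (mem_univ k)
  have hupper : Real.log (∑ i, Real.exp (a i)) ≤ Real.log (Fintype.card ι) + M := by
    rw [← Real.log_exp M, ← Real.log_mul hcard.ne' (Real.exp_pos _).ne']
    refine Real.log_le_log hpos ?_
    calc ∑ i, Real.exp (a i) ≤ ∑ _i : ι, Real.exp M :=
          Finset.sum_le_sum fun i _ => Real.exp_le_exp.2 (abs_le.1 (ha i)).2
      _ = Fintype.card ι * Real.exp M := by simp
  rw [Real.log_div (Real.exp_pos _).ne' hpos.ne', Real.log_exp, abs_le]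
  constructor <;> linarith

theorem abs_gamFull_le {K : ℕ} (γ : Fin K → ℝ) (l : Fin (K + 1)) : |gamFull γ l| ≤ ‖γ‖ := by
  refine Fin.cases ?_ (fun i => ?_) l
  · simp [gamFull]
  · simpa [gamFull] using norm_le_pi_norm γ i

theorem continuous_gamFull {K : ℕ} (l : Fin (K + 1)) :
    Continuous fun γ : Fin K → ℝ => gamFull γ l := by
  refine Fin.cases ?_ (fun i => ?_) l
  · simpa [gamFull] using continuous_const
  · simpa [gamFull] using continuous_apply i

section Eta

variable {Ω : Type*} {S K : ℕ} {ψ : Ω → Fin (K + 1) → (Fin S → ℝ) → ℝ}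

theorem sum_exp_gamFull_pos (x : Ω) (lam : Param S K) :
    0 < ∑ l : Fin (K + 1), Real.exp (gamFull lam.2 l + ψ x l lam.1) :=
  Finset.sum_pos (fun _ _ => Real.exp_pos _) univ_nonempty

theorem continuous_eta (hψ : ∀ x k, Continuous (ψ x k)) (k : Fin (K + 1)) (x : Ω) :
    Continuous (eta ψ k x) := by
  have hterm (l : Fin (K + 1)) :
      Continuous fun lam : Param S K => Real.exp (gamFull lam.2 l + ψ x l lam.1) :=
    Real.continuous_exp.comp <|
      ((continuous_gamFull l).comp continuous_snd).add ((hψ x l).comp continuous_fst)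
  exact ((hterm k).div (continuous_finsetSum _ fun l _ => hterm l)
    fun lam => (sum_exp_gamFull_pos x lam).ne').log
    fun lam => (div_pos (Real.exp_pos _) (sum_exp_gamFull_pos x lam)).ne'

theorem measurable_eta [MeasurableSpace Ω] (hψ : ∀ k θ, Measurable fun x => ψ x k θ)
    (k : Fin (K + 1)) (lam : Param S K) : Measurable fun x => eta ψ k x lam := by
  unfold eta pfun
  have := fun l => hψ l lam.1
  fun_prop

theorem abs_eta_le_of_norm_le {ψt : Ω → ℝ} (hψt : ∀ x, 0 ≤ ψt x)
    (hbound : ∀ x k θ, |ψ x k θ| ≤ ψt x * ‖θ‖) (k : Fin (K + 1)) (x : Ω) {lam : Param S K} {R : ℝ}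
    (hR : ‖lam‖ ≤ R) :
    |eta ψ k x lam| ≤ Real.log (K + 1) + 2 * (R + ψt x * R) := by
  have hterm (l : Fin (K + 1)) : |gamFull lam.2 l + ψ x l lam.1| ≤ R + ψt x * R :=
    (abs_add_le _ _).trans <| add_le_add
      ((abs_gamFull_le _ l).trans ((norm_snd_le lam).trans hR))
      ((hbound x l lam.1).trans
        (mul_le_mul_of_nonneg_left ((norm_fst_le lam).trans hR) (hψt x)))
  simpa [eta, pfun] using abs_log_exp_div_sum_exp_le hterm k

end Eta

/-- Lemma A.2 of Osius: under Conditions (OR2) and (C2),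
`lim_{ε→0⁺} ∫ sup_{‖λ'−λ‖≤ε} η_k(x;λ') dμ_k(x) = ∫ η_k(x;λ) dμ_k(x)`,
all the integrals being finite. -/
theorem sup_integral_continuity
    {Ω : Type*} [MeasurableSpace Ω] (ν : Measure Ω) [SigmaFinite ν]
    (K S : ℕ) (hK : 1 ≤ K) (hS : 1 ≤ S)
    (q : Fin (K + 1) → Ω → ℝ)
    (hq_meas : ∀ k, Measurable (q k))
    (hq_pos : ∀ k x, 0 < q k x)
    (hq_norm : ∀ k, ∫ x, q k x ∂ν = 1)
    (r : Fin (K + 1) → ℝ) (hr_pos : ∀ k, 0 < r k) (hr_sum : ∑ k, r k = 1)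
    (ψ : Ω → Fin (K + 1) → (Fin S → ℝ) → ℝ)
    (hψ_meas : ∀ k θ, Measurable (fun x => ψ x k θ))
    (hψ_zero : ∀ x θ, ψ x 0 θ = 0)
    (lam₀ : Param S K)
    (hspec : ∀ k, ∀ᵐ x ∂ν,
      pfun ψ k x lam₀ = r k * q k x / ∑ l, r l * q l x)
    -- continuity of θ ↦ ψ(x,k,θ)
    (hψ_cont : ∀ x k, Continuous (fun θ => ψ x k θ))
    -- Conditions (OR2) and (C2)
    (ψt : Ω → ℝ) (hψt_meas : Measurable ψt) (hψt_nonneg : ∀ x, 0 ≤ ψt x)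
    (hbound : ∀ x k θ, |ψ x k θ| ≤ ψt x * ‖θ‖)
    (hψt_int : ∀ k, Integrable ψt (densMeasure ν q k)) :
    ∀ (k : Fin (K + 1)) (lam : Param S K),
      Integrable (fun x => eta ψ k x lam) (densMeasure ν q k) ∧
      (∀ ε : ℝ, 0 < ε →
        Integrable
          (fun x => ⨆ lam' : (Metric.closedBall lam ε : Set (Param S K)),
            eta ψ k x ↑lam') (densMeasure ν q k)) ∧
      Tendsto
        (fun ε : ℝ =>
          ∫ x, (⨆ lam' : (Metric.closedBall lam ε : Set (Param S K)),
            eta ψ k x ↑lam') ∂(densMeasure ν q k))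
        (nhdsWithin 0 (Set.Ioi 0))
        (nhds (∫ x, eta ψ k x lam ∂(densMeasure ν q k))) := by
  intro k lam
  have hq_int : Integrable (q k) ν := by
    by_contra h
    simpa [integral_undef h] using hq_norm k
  have : IsFiniteMeasure (densMeasure ν q k) := isFiniteMeasure_withDensity_ofReal hq_int.2
  have hdom_int (ε : ℝ) : Integrable
      (fun x => Real.log (K + 1) + 2 * ((‖lam‖ + ε) + ψt x * (‖lam‖ + ε)))
      (densMeasure ν q k) :=
    (integrable_const _).add
      (((integrable_const _).add ((hψt_int k).mul_const _)).const_mul _)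
  have hdom (ε : ℝ) (x : Ω) (lam' : Param S K) (h : lam' ∈ closedBall lam ε) :
      |eta ψ k x lam'| ≤ Real.log (K + 1) + 2 * ((‖lam‖ + ε) + ψt x * (‖lam‖ + ε)) :=
    abs_eta_le_of_norm_le hψt_nonneg hbound k x (norm_le_of_mem_closedBall h)
  have hmeas := measurable_eta hψ_meas k
  have hcont := continuous_eta hψ_cont k
  exact ⟨(hdom_int 0).mono' (hmeas lam).aestronglyMeasurable
      (.of_forall fun x => hdom 0 x lam (mem_closedBall_self le_rfl)),
    fun ε hε => (hdom_int ε).mono'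
      (measurable_iSup_closedBall hmeas hcont lam ε).aestronglyMeasurable
      (.of_forall fun x => abs_iSup_closedBall_le hε.le (hdom ε x)),
    tendsto_integral_iSup_closedBall hmeas hcont one_pos (hdom_int 1) (hdom 1)⟩
end
end
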